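/- arXiv:math-ph/0511072 — 3 statements merged into one kernel-verified Lean document; each statement's English description precedes it below -/
import Mathlib

section
/- Let X be a Banach space, H a complex Hilbert space, and let 0 < p < 1 and q > p/(1-p). Then there exists a constant c = c_{p,q} > 0 (depending only on p and q) such that for every p-nuclear bounded linear map T : X → H and every ε > 0, the ε-content of T satisfies N_T(ε) ≤ exp(c · ‖T‖_p^q / ε^q). -/
open scoped ENNReal NNReal

noncomputable section

/-- `NuclearRep T f y` says that the sequences `f` of bounded functionals and `y` of vectors
form a nuclear representation of the bounded operator `T`, i.e. `T x = ∑ n, f n x • y n`. -/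
def NuclearRep {X Y : Type*} [NormedAddCommGroup X] [NormedSpace ℂ X]
    [NormedAddCommGroup Y] [NormedSpace ℂ Y]
    (T : X →L[ℂ] Y) (f : ℕ → X →L[ℂ] ℂ) (y : ℕ → Y) : Prop :=
  ∀ x : X, HasSum (fun n => f n x • y n) (T x)

/-- A bounded operator `T` between Banach spaces is `p`-nuclear if it admits a nuclear
representation `T x = ∑ n, f n x • y n` with `∑ n, ‖f n‖^p * ‖y n‖^p < ∞`. -/
def IsPNuclear {X Y : Type*} [NormedAddCommGroup X] [NormedSpace ℂ X]
    [NormedAddCommGroup Y] [NormedSpace ℂ Y] (p : ℝ) (T : X →L[ℂ] Y) : Prop :=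
  ∃ (f : ℕ → X →L[ℂ] ℂ) (y : ℕ → Y), NuclearRep T f y ∧
    Summable (fun n => ‖f n‖ ^ p * ‖y n‖ ^ p)

/-- The nuclear `p`-norm of `T`: the infimum of `(∑ n, ‖f n‖^p * ‖y n‖^p)^(1/p)` over all
nuclear representations of `T`. -/
noncomputable def pNuclearNorm {X Y : Type*} [NormedAddCommGroup X] [NormedSpace ℂ X]
    [NormedAddCommGroup Y] [NormedSpace ℂ Y] (p : ℝ) (T : X →L[ℂ] Y) : ℝ :=
  sInf {c : ℝ | ∃ (f : ℕ → X →L[ℂ] ℂ) (y : ℕ → Y), NuclearRep T f y ∧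
    Summable (fun n => ‖f n‖ ^ p * ‖y n‖ ^ p) ∧
    c = (∑' n, ‖f n‖ ^ p * ‖y n‖ ^ p) ^ (1 / p)}

/-- The `ε`-content of a bounded operator `T`: the maximal number `N` (possibly `∞`) of
elements of the closed unit ball of `X` whose images under `T` are pairwise more than `ε`
apart. -/
noncomputable def epsContent {X Y : Type*} [NormedAddCommGroup X] [NormedSpace ℂ X]
    [NormedAddCommGroup Y] [NormedSpace ℂ Y] (T : X →L[ℂ] Y) (ε : ℝ) : ℕ∞ :=
  sSup {N : ℕ∞ | ∃ (n : ℕ) (x : Fin n → X), N = (n : ℕ∞) ∧ (∀ i, ‖x i‖ ≤ 1) ∧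
    ∀ i j, i ≠ j → ε < ‖T (x i) - T (x j)‖}

lemma exists_code_real {k : ℕ} (hk : 0 < k) :
    ∃ g : ℝ → Fin (k + 1), ∀ s ∈ Set.Icc (-1 : ℝ) 1, ∀ t ∈ Set.Icc (-1 : ℝ) 1,
      g s = g t → |s - t| ≤ 2 / k := by
  refine ⟨fun t => ⟨min k ⌊k * (t + 1) / 2⌋₊, by omega⟩, ?_⟩
  rintro s ⟨hs1, hs2⟩ t ⟨ht1, ht2⟩ h
  have hk' : (0 : ℝ) < k := by exact_mod_cast hk
  have key : ∀ u : ℝ, u ≤ 1 → ⌊k * (u + 1) / 2⌋₊ ≤ k := fun u hu =>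
    Nat.floor_le_of_le (by nlinarith)
  have h' : ⌊k * (s + 1) / 2⌋₊ = ⌊k * (t + 1) / 2⌋₊ := by
    simpa [Fin.ext_iff, key s hs2, key t ht2] using h
  have s1 := Nat.floor_le (show 0 ≤ k * (s + 1) / 2 by
    have : 0 ≤ s + 1 := by linarith
    positivity)
  have t1 := Nat.floor_le (show 0 ≤ k * (t + 1) / 2 by
    have : 0 ≤ t + 1 := by linarith
    positivity)
  have s2 := Nat.lt_floor_add_one (k * (s + 1) / 2)
  have t2 := Nat.lt_floor_add_one (k * (t + 1) / 2)
  rw [h'] at s1 s2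
  rw [abs_le, le_div_iff₀ hk', ← neg_div, div_le_iff₀ hk']
  constructor <;> nlinarith

lemma exists_code_complex {k : ℕ} (hk : 0 < k) :
    ∃ g : ℂ → Fin (k + 1) × Fin (k + 1), ∀ z w : ℂ, ‖z‖ ≤ 1 → ‖w‖ ≤ 1 →
      g z = g w → ‖z - w‖ ≤ 4 / k := by
  obtain ⟨g, hg⟩ := exists_code_real hk
  refine ⟨fun z => (g z.re, g z.im), fun z w hz hw h => ?_⟩
  obtain ⟨hre, him⟩ := Prod.ext_iff.1 h
  have r := hg z.re (abs_le.1 ((Complex.abs_re_le_norm z).trans hz))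
    w.re (abs_le.1 ((Complex.abs_re_le_norm w).trans hw)) hre
  have i := hg z.im (abs_le.1 ((Complex.abs_im_le_norm z).trans hz))
    w.im (abs_le.1 ((Complex.abs_im_le_norm w).trans hw)) him
  calc ‖z - w‖ ≤ |(z - w).re| + |(z - w).im| := Complex.norm_le_abs_re_add_abs_im _
    _ ≤ 2 / k + 2 / k := by simpa using add_le_add r i
    _ = 4 / k := by ring

section Separated

variable {X Y : Type*} [NormedAddCommGroup X] [NormedSpace ℂ X]
  [NormedAddCommGroup Y] [NormedSpace ℂ Y] {T : X →L[ℂ] Y} {f : ℕ → X →L[ℂ] ℂ} {y : ℕ → Y}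
  {N : ℕ} {x : Fin N → X} {ε : ℝ}

/-- Pigeonhole bound: quantize the coordinates in `B` on a grid with `(k n + 1) ^ 2` cells and
ignore all the other coordinates. -/
lemma card_le_prod_of_separated (hT : NuclearRep T f y) (hx : ∀ i, ‖x i‖ ≤ 1)
    (hsep : ∀ i j, i ≠ j → ε < ‖T (x i) - T (x j)‖)
    (B : Finset ℕ) (k : ℕ → ℕ) (hk : ∀ n, 0 < k n) (w : ℕ → ℝ) (hw : Summable w)
    (hwε : ∑' n, w n ≤ ε) (hB : ∀ n ∈ B, ‖f n‖ * ‖y n‖ * (4 / k n) ≤ w n)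
    (hB' : ∀ n ∉ B, ‖f n‖ * ‖y n‖ * 2 ≤ w n) :
    N ≤ ∏ n ∈ B, (k n + 1) ^ 2 := by
  choose g hg using fun n => exists_code_complex (hk n)
  let z : ℕ → X → ℂ := fun n v => f n v / ‖f n‖
  have hz : ∀ n i, ‖z n (x i)‖ ≤ 1 := fun n i => by
    simp only [z, norm_div, Complex.norm_real, norm_norm]
    refine div_le_one_of_le₀ (((f n).le_opNorm _).trans ?_) (norm_nonneg _)
    exact mul_le_of_le_one_right (norm_nonneg _) (hx i)
  have hfz : ∀ n v, f n v = ‖f n‖ * z n v := fun n v => by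
    by_cases h : f n = 0
    · simp [h]
    · have : (‖f n‖ : ℂ) ≠ 0 := by simpa using h
      simp only [z]
      field_simp
  let code : Fin N → (n : B) → Fin (k n + 1) × Fin (k n + 1) := fun i n => g n (z n (x i))
  have hinj : Function.Injective code := by
    intro i j hij
    by_contra hne
    refine absurd (hsep i j hne) (not_lt.2 (le_trans ?_ hwε))
    have hsum := (hT (x i)).sub (hT (x j))
    rw [← hsum.tsum_eq]
    refine tsum_of_norm_bounded hw.hasSum fun n => ?_
    have hnorm : ‖f n (x i) • y n - f n (x j) • y n‖
        = ‖f n‖ * ‖y n‖ * ‖z n (x i) - z n (x j)‖ := by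
      rw [← sub_smul, hfz n (x i), hfz n (x j), ← mul_sub, norm_smul, norm_mul,
        Complex.norm_real, norm_norm]
      ring
    rw [hnorm]
    by_cases hn : n ∈ B
    · refine le_trans ?_ (hB n hn)
      gcongr
      exact hg n _ _ (hz n i) (hz n j) (congrFun hij ⟨n, hn⟩)
    · refine le_trans ?_ (hB' n hn)
      gcongr
      exact (norm_sub_le _ _).trans (by linarith [hz n i, hz n j])
  have hcard := Fintype.card_le_of_injective code hinj
  rw [Fintype.card_fin, Fintype.card_pi] at hcard
  simp only [Fintype.card_prod, Fintype.card_fin] at hcard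
  rw [← Finset.prod_coe_sort]
  simpa [pow_two] using hcard

/-- The logarithm of the number of cells of a grid of mesh `r ^ (p - 1)` is at most a multiple
of `r ^ p`. -/
lemma sq_ceil_add_one_le_exp {p r : ℝ} (hp0 : 0 < p) (hp1 : p < 1) (hr : 1 ≤ r) :
    ((⌈r ^ (1 - p)⌉₊ : ℝ) + 1) ^ 2 ≤ Real.exp ((4 + 2 / p) * r ^ p) := by
  have hr0 : 0 < r := by linarith
  have h1 : 1 ≤ r ^ (1 - p) := Real.one_le_rpow hr (by linarith)
  have h2 : 1 ≤ r ^ p := Real.one_le_rpow hr hp0.le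
  have hc := (Nat.ceil_lt_add_one (by positivity : 0 ≤ r ^ (1 - p))).le
  have h3 : r ^ (1 - p) ≤ Real.exp (r ^ p / p) := by
    rw [Real.rpow_def_of_pos hr0, Real.exp_le_exp]
    have hl := Real.log_le_rpow_div hr0.le hp0
    have hl0 := Real.log_nonneg hr
    nlinarith
  have h4 : (3 : ℝ) ≤ Real.exp (2 * r ^ p) := by
    have := Real.add_one_le_exp (2 * r ^ p)
    linarith
  calc ((⌈r ^ (1 - p)⌉₊ : ℝ) + 1) ^ 2 ≤ (3 * r ^ (1 - p)) ^ 2 := by gcongr; linarith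
    _ ≤ (Real.exp (2 * r ^ p) * Real.exp (r ^ p / p)) ^ 2 := by gcongr
    _ = Real.exp ((4 + 2 / p) * r ^ p) := by
      rw [← Real.exp_add, ← Real.exp_nat_mul]
      congr 1
      push_cast
      field_simp
      ring

lemma card_le_exp_sum_of_separated {p τ : ℝ} (hp0 : 0 < p) (hp1 : p < 1) (hτ : 0 < τ)
    (hT : NuclearRep T f y) (hs : Summable fun n => ‖f n‖ ^ p * ‖y n‖ ^ p)
    (hx : ∀ i, ‖x i‖ ≤ 1) (hsep : ∀ i j, i ≠ j → ε < ‖T (x i) - T (x j)‖)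
    (hτε : 4 * (∑' n, ‖f n‖ ^ p * ‖y n‖ ^ p) * τ ^ (1 - p) ≤ ε)
    (B : Finset ℕ) (hB : ∀ n, n ∈ B ↔ τ < ‖f n‖ * ‖y n‖) :
    (N : ℝ) ≤ Real.exp (∑ n ∈ B, (4 + 2 / p) * (‖f n‖ ^ p * ‖y n‖ ^ p / τ ^ p)) := by
  have hpow : ∀ n, ‖f n‖ ^ p * ‖y n‖ ^ p = (‖f n‖ * ‖y n‖) ^ p := fun n =>
    (Real.mul_rpow (norm_nonneg _) (norm_nonneg _)).symm
  simp only [hpow] at hs hτε ⊢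
  have hsplit : ∀ a : ℝ, 0 < a → a = a ^ p * a ^ (1 - p) := fun a ha => by
    rw [← Real.rpow_add ha]; simp
  have hτp : 0 < τ ^ (1 - p) := by positivity
  have hcard := card_le_prod_of_separated hT hx hsep B
    (fun n => ⌈(‖f n‖ * ‖y n‖ / τ) ^ (1 - p)⌉₊ + if n ∈ B then 0 else 1) (fun n => by
      split_ifs with h
      · have : 0 < ‖f n‖ * ‖y n‖ := hτ.trans ((hB n).1 h)
        exact Nat.add_pos_left (Nat.ceil_pos.2 (by positivity)) _
      · omega)
    (fun n => 4 * (‖f n‖ * ‖y n‖) ^ p * τ ^ (1 - p)) ((hs.mul_left 4).mul_right _)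
    (by rwa [tsum_mul_right, tsum_mul_left]) (fun n hn => by
      have ha : 0 < ‖f n‖ * ‖y n‖ := hτ.trans ((hB n).1 hn)
      generalize ‖f n‖ * ‖y n‖ = a at ha
      have hc := Nat.le_ceil ((a / τ) ^ (1 - p))
      have hpos : 0 < (a / τ) ^ (1 - p) := by positivity
      simp only [hn, if_true, add_zero]
      calc a * (4 / (⌈(a / τ) ^ (1 - p)⌉₊ : ℝ)) ≤ a * (4 / (a / τ) ^ (1 - p)) := by gcongr
        _ = 4 * a ^ p * τ ^ (1 - p) := by
          rw [Real.div_rpow ha.le hτ.le]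
          have : 0 < a ^ (1 - p) := by positivity
          field_simp
          linear_combination hsplit a ha)
    (fun n hn => by
      have hle : ‖f n‖ * ‖y n‖ ≤ τ := not_lt.1 fun h => hn ((hB n).2 h)
      have ha : 0 ≤ ‖f n‖ * ‖y n‖ := by positivity
      generalize ‖f n‖ * ‖y n‖ = a at ha hle
      rcases ha.eq_or_lt with rfl | ha
      · simp [Real.zero_rpow hp0.ne']
      · have h1 : a ^ (1 - p) ≤ τ ^ (1 - p) := Real.rpow_le_rpow ha.le hle (by linarith)
        have h2 : 0 < a ^ p := by positivity
        have h3 := hsplit a ha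
        nlinarith [mul_le_mul_of_nonneg_left h1 h2.le])
  rw [Real.exp_sum]
  calc (N : ℝ) ≤ _ := Nat.cast_le.2 hcard
    _ ≤ _ := by
      push_cast
      refine Finset.prod_le_prod (fun _ _ => by positivity) fun n hn => ?_
      rw [← Real.div_rpow (by positivity) hτ.le]
      simp only [hn, if_true, add_zero]
      exact sq_ceil_add_one_le_exp hp0 hp1 ((one_le_div hτ).2 ((hB n).1 hn).le)

lemma card_le_exp_of_separated {p q : ℝ} (hp0 : 0 < p) (hp1 : p < 1) (hq : p / (1 - p) < q)
    (hε : 0 < ε) (hT : NuclearRep T f y) (hs : Summable fun n => ‖f n‖ ^ p * ‖y n‖ ^ p)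
    (hx : ∀ i, ‖x i‖ ≤ 1) (hsep : ∀ i j, i ≠ j → ε < ‖T (x i) - T (x j)‖) :
    (N : ℝ) ≤ Real.exp ((4 + 2 / p) * 4 ^ q *
      ((∑' n, ‖f n‖ ^ p * ‖y n‖ ^ p) ^ (1 / p)) ^ q / ε ^ q) := by
  have hp1' : 0 < 1 - p := by linarith
  have hA0 : 0 ≤ ∑' n, ‖f n‖ ^ p * ‖y n‖ ^ p := tsum_nonneg fun n => by positivity
  have hpow : ∀ n, ‖f n‖ ^ p * ‖y n‖ ^ p = (‖f n‖ * ‖y n‖) ^ p := fun n =>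
    (Real.mul_rpow (norm_nonneg _) (norm_nonneg _)).symm
  have hle := fun n => hs.le_tsum n fun m _ => by positivity
  set A := ∑' n, ‖f n‖ ^ p * ‖y n‖ ^ p with hA
  set S := A ^ (1 / p) with hS
  have hS0 : 0 ≤ S := by positivity
  have hSA : S ^ p = A := by
    rw [hS, ← Real.rpow_mul hA0, one_div_mul_cancel hp0.ne', Real.rpow_one]
  have haS : ∀ n, ‖f n‖ * ‖y n‖ ≤ S := fun n => by
    rw [← Real.rpow_le_rpow_iff (by positivity) hS0 hp0, hSA, ← hpow]
    exact hle n
  rcases le_or_gt (4 * S) ε with h | h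
  · have hε4 : 0 < ε / 4 := by positivity
    have h1 := card_le_exp_sum_of_separated hp0 hp1 hε4 hT hs hx hsep (by
      have h2 : S ^ p ≤ (ε / 4) ^ p := Real.rpow_le_rpow hS0 (by linarith) hp0.le
      have h3 : (ε / 4) ^ p * (ε / 4) ^ (1 - p) = ε / 4 := by
        rw [← Real.rpow_add hε4]; simp
      have h4 : 0 < (ε / 4) ^ (1 - p) := by positivity
      rw [← hA, ← hSA]
      nlinarith) ∅ (fun n => by
      simp only [Finset.notMem_empty, false_iff, not_lt]
      linarith [haS n])
    refine h1.trans (Real.exp_le_exp.2 ?_)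
    rw [Finset.sum_empty]
    positivity
  · have hSpos : 0 < S := by linarith
    have hApos : 0 < A := hSA ▸ Real.rpow_pos_of_pos hSpos p
    set τ := (ε / (4 * A)) ^ (1 / (1 - p)) with hτ
    have hτ0 : 0 < τ := by positivity
    have hτ1 : τ ^ (1 - p) = ε / (4 * A) := by
      rw [hτ, ← Real.rpow_mul (by positivity), one_div_mul_cancel hp1'.ne', Real.rpow_one]
    have hfin : {n | τ < ‖f n‖ * ‖y n‖}.Finite := by
      have h1 := hs.tendsto_cofinite_zero.eventually (gt_mem_nhds (Real.rpow_pos_of_pos hτ0 p))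
      refine (Filter.eventually_cofinite.1 h1).subset fun n hn => ?_
      rw [Set.mem_ofPred_eq, not_lt, hpow]
      exact Real.rpow_le_rpow hτ0.le (le_of_lt hn) hp0.le
    refine (card_le_exp_sum_of_separated hp0 hp1 hτ0 hT hs hx hsep
      (by rw [hτ1, ← hA]; exact le_of_eq (by field_simp)) hfin.toFinset
      (fun n => by simp)).trans (Real.exp_le_exp.2 ?_)
    have hAτ : A / τ ^ p = (4 * S / ε) ^ (p / (1 - p)) := by
      have e1 : τ ^ p = (ε / (4 * A)) ^ (p / (1 - p)) := by
        rw [hτ, ← Real.rpow_mul (by positivity), one_div_mul_eq_div]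
      have e2 : S ^ (p / (1 - p)) = A * A ^ (p / (1 - p)) := by
        rw [hS, ← Real.rpow_mul hA0, ← Real.rpow_one_add' hA0 (by positivity)]
        congr 1
        field_simp
        ring
      rw [e1, Real.div_rpow hε.le (by positivity), Real.div_rpow (by positivity) hε.le,
        Real.mul_rpow (by norm_num) hA0, Real.mul_rpow (by norm_num) hS0, e2]
      field_simp
    calc ∑ n ∈ hfin.toFinset, (4 + 2 / p) * (‖f n‖ ^ p * ‖y n‖ ^ p / τ ^ p)
        = (4 + 2 / p) * ((∑ n ∈ hfin.toFinset, ‖f n‖ ^ p * ‖y n‖ ^ p) / τ ^ p) := by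
          rw [← Finset.mul_sum, Finset.sum_div]
      _ ≤ (4 + 2 / p) * (A / τ ^ p) := by
          gcongr
          exact hs.sum_le_tsum _ fun _ _ => by positivity
      _ ≤ (4 + 2 / p) * (4 * S / ε) ^ q := by
          rw [hAτ]
          gcongr
          exact (one_le_div hε).2 h.le
      _ = (4 + 2 / p) * 4 ^ q * S ^ q / ε ^ q := by
          rw [Real.div_rpow (by positivity) hε.le, Real.mul_rpow (by norm_num) hS0]
          ring

end Separated

/-- Lemma A.2 (i): for `0 < p < 1` and `q > p/(1-p)` there is a constant
`c = c_{p,q} > 0` such that for every `p`-nuclear map `T` from a Banach space to a complex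
Hilbert space and every `ε > 0`, the `ε`-content of `T` satisfies
`N_T(ε) ≤ exp (c * ‖T‖_p ^ q / ε ^ q)`. -/
theorem epsContent_le_of_isPNuclear (p q : ℝ) (hp0 : 0 < p) (hp1 : p < 1)
    (hq : p / (1 - p) < q) :
    ∃ c : ℝ, 0 < c ∧
      ∀ (X H : Type) (_ : NormedAddCommGroup X) (_ : NormedSpace ℂ X) (_ : CompleteSpace X)
        (_ : NormedAddCommGroup H) (_ : InnerProductSpace ℂ H) (_ : CompleteSpace H)
        (T : X →L[ℂ] H), IsPNuclear p T → ∀ ε : ℝ, 0 < ε →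
          (epsContent T ε : ℝ≥0∞) ≤
            ENNReal.ofReal (Real.exp (c * pNuclearNorm p T ^ q / ε ^ q)) := by
  have hq0 : 0 < q := (div_pos hp0 (by linarith)).trans hq
  refine ⟨(4 + 2 / p) * 4 ^ q, by positivity, ?_⟩
  intro X H _ _ _ _ _ _ T hT ε hε
  have hbound : ∀ N : ℕ, ∀ x : Fin N → X, (∀ i, ‖x i‖ ≤ 1) →
      (∀ i j, i ≠ j → ε < ‖T (x i) - T (x j)‖) →
      (N : ℝ) ≤ Real.exp ((4 + 2 / p) * 4 ^ q * pNuclearNorm p T ^ q / ε ^ q) := by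
    intro N x hx hsep
    have hclosed : IsClosed
        {s : ℝ | (N : ℝ) ≤ Real.exp ((4 + 2 / p) * 4 ^ q * s ^ q / ε ^ q)} := by
      have := Real.continuous_rpow_const hq0.le
      exact isClosed_le continuous_const (by fun_prop)
    refine closure_minimal ?_ hclosed (csInf_mem_closure (s := {c : ℝ |
      ∃ (f : ℕ → X →L[ℂ] ℂ) (y : ℕ → H), NuclearRep T f y ∧
        Summable (fun n => ‖f n‖ ^ p * ‖y n‖ ^ p) ∧
        c = (∑' n, ‖f n‖ ^ p * ‖y n‖ ^ p) ^ (1 / p)}) ?_ ?_)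
    · rintro _ ⟨f, y, hrep, hs, rfl⟩
      exact card_le_exp_of_separated hp0 hp1 hq hε hrep hs hx hsep
    · obtain ⟨f, y, hrep, hs⟩ := hT
      exact ⟨_, f, y, hrep, hs, rfl⟩
    · refine ⟨0, ?_⟩
      rintro _ ⟨f, y, -, -, rfl⟩
      have : 0 ≤ ∑' n, ‖f n‖ ^ p * ‖y n‖ ^ p := tsum_nonneg fun n => by positivity
      positivity
  set R := Real.exp ((4 + 2 / p) * 4 ^ q * pNuclearNorm p T ^ q / ε ^ q)
  have hle : epsContent T ε ≤ (⌊R⌋₊ : ℕ∞) := by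
    refine sSup_le ?_
    rintro _ ⟨N, x, rfl, hx, hsep⟩
    exact_mod_cast Nat.le_floor (hbound N x hx hsep)
  calc (epsContent T ε : ℝ≥0∞) ≤ ((⌊R⌋₊ : ℕ∞) : ℝ≥0∞) := ENat.toENNReal_le.2 hle
    _ = ENNReal.ofReal (⌊R⌋₊ : ℝ) := by simp
    _ ≤ ENNReal.ofReal R := ENNReal.ofReal_le_ofReal (Nat.floor_le (Real.exp_pos _).le)
end
end

section
/- Let X be a Banach space, H a complex Hilbert space, and 0 < p ≤ 1. Then there exists a constant d = d_p > 0 (depending only on p) such that the following holds: if T : X → H is a bounded linear map and (ε_m)_{m∈ℕ} is a sequence of positive numbers such that each ε_m-content N_T(ε_m) is finite and Σ_{m=1}^∞ (m^{1/2} · ε_m · N_T(ε_m)^{1/m})^p < ∞, then T is p-nuclear and ‖T‖_p ≤ d · (Σ_{m=1}^∞ (m^{1/2} · ε_m · N_T(ε_m)^{1/m})^p)^{1/p}. -/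
open scoped ENNReal NNReal

noncomputable section

open MeasureTheory Filter Topology

section Content

variable {X Y : Type*} [NormedAddCommGroup X] [NormedSpace ℂ X]
  [NormedAddCommGroup Y] [NormedSpace ℂ Y]

/-- A finite `ε`-content is attained by a family whose images form an `ε`-net of the image of the
closed unit ball. -/
lemma exists_net_of_epsContent_ne_top (T : X →L[ℂ] Y) {ε : ℝ} (h : epsContent T ε ≠ ⊤) :
    ∃ z : Fin (epsContent T ε).toNat → X,
      ∀ x : X, ‖x‖ ≤ 1 → ∃ i, ‖T x - T (z i)‖ ≤ ε := by
  obtain ⟨n, z, hn, hz, hsep⟩ := Set.Nonempty.csSup_mem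
    (s := {N : ℕ∞ | ∃ (n : ℕ) (x : Fin n → X), N = (n : ℕ∞) ∧ (∀ i, ‖x i‖ ≤ 1) ∧
      ∀ i j, i ≠ j → ε < ‖T (x i) - T (x j)‖})
    ⟨0, 0, Fin.elim0, by simp⟩ (ENat.finite_of_sSup_lt_top (lt_top_iff_ne_top.mpr h))
  change epsContent T ε = n at hn
  rw [hn, ENat.toNat_natCast]
  refine ⟨z, fun x hx => ?_⟩
  by_contra! hfar
  have hmem : ((n + 1 : ℕ) : ℕ∞) ≤ epsContent T ε := by
    refine le_sSup ⟨n + 1, Fin.cons x z, rfl, ?_, ?_⟩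
    · intro i
      refine Fin.cases ?_ (fun i => ?_) i
      · simpa using hx
      · simpa using hz i
    · intro i j
      refine Fin.cases ?_ (fun i => ?_) i <;> refine Fin.cases ?_ (fun j => ?_) j
      · simp
      · intro _
        simpa using hfar j
      · intro _
        rw [norm_sub_rev]
        simpa using hfar i
      · intro hij
        simpa using hsep i j (by simpa using hij)
  rw [hn, Nat.cast_le] at hmem
  omega

end Content

section Deflation

variable {X H : Type*} [NormedAddCommGroup X] [NormedSpace ℂ X]
  [NormedAddCommGroup H] [InnerProductSpace ℂ H]

lemma exists_opNorm_le_two_mul (R : X →L[ℂ] H) : ∃ x : X, ‖x‖ ≤ 1 ∧ ‖R‖ ≤ 2 * ‖R x‖ := by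
  rcases (norm_nonneg R).eq_or_lt with h | h
  · exact ⟨0, by simp, by simp [← h]⟩
  · obtain ⟨x, hx, hR⟩ := R.exists_lt_apply_of_lt_opNorm (half_lt_self h)
    exact ⟨x, hx.le, by linarith⟩

/-- A vector of the unit ball at which `R` attains its norm up to a factor `2`. -/
def almostNorming (R : X →L[ℂ] H) : X := (exists_opNorm_le_two_mul R).choose

lemma norm_almostNorming_le (R : X →L[ℂ] H) : ‖almostNorming R‖ ≤ 1 :=
  (exists_opNorm_le_two_mul R).choose_spec.1

lemma opNorm_le_two_mul_almostNorming (R : X →L[ℂ] H) : ‖R‖ ≤ 2 * ‖R (almostNorming R)‖ :=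
  (exists_opNorm_le_two_mul R).choose_spec.2

/-- The normalized image of the almost norming vector; it is `0` if `R = 0`. -/
def leadingDirection (R : X →L[ℂ] H) : H :=
  ((‖R (almostNorming R)‖⁻¹ : ℝ) : ℂ) • R (almostNorming R)

lemma apply_almostNorming (R : X →L[ℂ] H) :
    R (almostNorming R) = (‖R (almostNorming R)‖ : ℂ) • leadingDirection R := by
  rcases eq_or_ne (R (almostNorming R)) 0 with h | h
  · simp [h]
  · rw [leadingDirection, smul_smul, ← Complex.ofReal_mul, mul_inv_cancel₀ (norm_ne_zero_iff.mpr h)]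
    simp

lemma norm_leadingDirection {R : X →L[ℂ] H} (h : R ≠ 0) : ‖leadingDirection R‖ = 1 := by
  have h1 : 0 < ‖R‖ := norm_pos_iff.mpr h
  have h2 : 0 < ‖R (almostNorming R)‖ := by linarith [opNorm_le_two_mul_almostNorming R]
  rw [leadingDirection, norm_smul, Complex.norm_real, norm_inv, norm_norm,
    inv_mul_cancel₀ h2.ne']

lemma leadingDirection_zero : leadingDirection (0 : X →L[ℂ] H) = 0 := by
  simp [leadingDirection]

lemma norm_leadingDirection_le (R : X →L[ℂ] H) : ‖leadingDirection R‖ ≤ 1 := by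
  rcases eq_or_ne R 0 with rfl | h
  · simp [leadingDirection_zero]
  · exact (norm_leadingDirection h).le

/-- The coordinate functional of `R` along its leading direction. -/
def leadingFunctional (R : X →L[ℂ] H) : X →L[ℂ] ℂ := innerSL ℂ (leadingDirection R) ∘L R

lemma leadingFunctional_apply (R : X →L[ℂ] H) (x : X) :
    leadingFunctional R x = inner ℂ (leadingDirection R) (R x) := rfl

lemma norm_leadingFunctional_le (R : X →L[ℂ] H) : ‖leadingFunctional R‖ ≤ ‖R‖ := by
  refine (ContinuousLinearMap.opNorm_comp_le _ _).trans ?_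
  rw [innerSL_apply_norm]
  exact mul_le_of_le_one_left (norm_nonneg _) (norm_leadingDirection_le R)

lemma leadingFunctional_almostNorming (R : X →L[ℂ] H) :
    leadingFunctional R (almostNorming R) = ‖R (almostNorming R)‖ := by
  rcases eq_or_ne R 0 with rfl | h
  · simp [leadingFunctional]
  · conv_lhs => rw [leadingFunctional_apply, apply_almostNorming, inner_smul_right,
      inner_self_eq_norm_sq_to_K, norm_leadingDirection h]
    simp

/-- `R` followed by the projection onto the orthogonal complement of its leading direction. -/
def deflate (R : X →L[ℂ] H) : X →L[ℂ] H :=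
  R - (leadingFunctional R).smulRight (leadingDirection R)

lemma deflate_apply (R : X →L[ℂ] H) (x : X) :
    deflate R x = R x - leadingFunctional R x • leadingDirection R := rfl

lemma inner_leadingDirection_deflate (R : X →L[ℂ] H) (x : X) :
    inner ℂ (leadingDirection R) (deflate R x) = 0 := by
  rcases eq_or_ne R 0 with rfl | h
  · simp [leadingDirection_zero]
  · rw [deflate_apply, inner_sub_right, inner_smul_right, inner_self_eq_norm_sq_to_K,
      norm_leadingDirection h, leadingFunctional_apply]
    simp

lemma norm_deflate_le (R : X →L[ℂ] H) : ‖deflate R‖ ≤ ‖R‖ := by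
  refine ContinuousLinearMap.opNorm_le_bound _ (norm_nonneg _) fun x => ?_
  refine le_trans ?_ (R.le_opNorm x)
  have hR : R x = leadingFunctional R x • leadingDirection R + deflate R x := by
    rw [deflate_apply]; abel
  have horth : inner ℂ (leadingFunctional R x • leadingDirection R) (deflate R x) = 0 := by
    rw [inner_smul_left, inner_leadingDirection_deflate, mul_zero]
  have := norm_add_sq_eq_norm_sq_add_norm_sq_of_inner_eq_zero _ _ horth
  rw [← hR] at this
  nlinarith [norm_nonneg (R x), norm_nonneg (deflate R x),
    mul_self_nonneg ‖leadingFunctional R x • leadingDirection R‖]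

lemma deflate_almostNorming (R : X →L[ℂ] H) : deflate R (almostNorming R) = 0 := by
  rw [deflate_apply, leadingFunctional_almostNorming, ← apply_almostNorming, sub_self]

lemma deflate_apply_eq_zero {R : X →L[ℂ] H} {x : X} (h : R x = 0) : deflate R x = 0 := by
  simp [deflate_apply, leadingFunctional_apply, h]

variable (T : X →L[ℂ] H)

/-- The operators obtained from `T` by successive deflation. -/
def deflation : ℕ → X →L[ℂ] H
  | 0 => T
  | n + 1 => deflate (deflation n)

lemma norm_deflation_antitone : Antitone fun n => ‖deflation T n‖ :=
  antitone_nat_of_succ_le fun n => norm_deflate_le (deflation T n)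

lemma apply_eq_sum_add_deflation (n : ℕ) (x : X) :
    T x = ∑ k ∈ Finset.range n,
      leadingFunctional (deflation T k) x • leadingDirection (deflation T k) + deflation T n x := by
  induction n with
  | zero => simp [deflation]
  | succ n ih =>
    rw [Finset.sum_range_succ, deflation, deflate_apply]
    conv_lhs => rw [ih]
    abel

lemma inner_leadingDirection_deflation {j k : ℕ} (h : j < k) (x : X) :
    inner ℂ (leadingDirection (deflation T j)) (deflation T k x) = 0 := by
  induction k, h using Nat.le_induction generalizing x with
  | base => exact inner_leadingDirection_deflate _ x
  | succ k _ ih =>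
    rw [deflation, deflate_apply, inner_sub_right, inner_smul_right,
      leadingDirection.eq_1 (deflation T k), inner_smul_right, ih, ih]
    simp

lemma inner_leadingDirection_of_lt {j k : ℕ} (h : j < k) :
    inner ℂ (leadingDirection (deflation T j)) (leadingDirection (deflation T k)) = 0 := by
  rw [leadingDirection.eq_1 (deflation T k), inner_smul_right,
    inner_leadingDirection_deflation T h, mul_zero]

lemma deflation_almostNorming {j k : ℕ} (h : j < k) :
    deflation T k (almostNorming (deflation T j)) = 0 := by
  induction k, h using Nat.le_induction with
  | base => exact deflate_almostNorming _
  | succ k _ ih => exact deflate_apply_eq_zero ih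

lemma leadingFunctional_deflation_apply (n : ℕ) (x : X) :
    leadingFunctional (deflation T n) x = inner ℂ (leadingDirection (deflation T n)) (T x) := by
  rw [apply_eq_sum_add_deflation T n x, inner_add_right, inner_sum, Finset.sum_eq_zero, zero_add,
    leadingFunctional_apply]
  intro k hk
  rw [inner_smul_right, inner_eq_zero_symm.mp
    (inner_leadingDirection_of_lt T (Finset.mem_range.mp hk)), mul_zero]

lemma orthonormal_leadingDirection {m : ℕ} (h : ∀ k < m, deflation T k ≠ 0) :
    Orthonormal ℂ fun k : Fin m => leadingDirection (deflation T k) := by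
  refine ⟨fun k => norm_leadingDirection (h k k.2), fun i j hij => ?_⟩
  rcases lt_or_gt_of_ne hij with hlt | hlt
  · exact inner_leadingDirection_of_lt T hlt
  · exact inner_eq_zero_symm.mp (inner_leadingDirection_of_lt T hlt)

/-- If the norms of the deflations are `p`-summable for some `0 < p ≤ 1`, then deflation yields a nuclear
representation. -/
lemma nuclearRep_of_summable_norm_deflation {p : ℝ} (hp0 : 0 < p) (hp1 : p ≤ 1)
    (h : Summable fun n => ‖deflation T n‖ ^ p) :
    NuclearRep T (fun n => leadingFunctional (deflation T n))
      (fun n => leadingDirection (deflation T n)) := by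
  have hsum : Summable fun n => ‖deflation T n‖ := by
    refine summable_of_isBigO_nat h (Asymptotics.IsBigO.of_bound 1 ?_)
    filter_upwards [h.tendsto_atTop_zero.eventually_le_const zero_lt_one] with n hn
    have hle : ‖deflation T n‖ ≤ 1 := by
      by_contra! hgt
      exact absurd hn (not_le.mpr (Real.one_lt_rpow hgt hp0))
    rw [one_mul, norm_norm, Real.norm_of_nonneg (by positivity)]
    simpa using Real.rpow_le_rpow_of_exponent_ge' (norm_nonneg _) hle hp0.le hp1
  intro x
  have hbound : ∀ n, ‖leadingFunctional (deflation T n) x • leadingDirection (deflation T n)‖ ≤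
      ‖deflation T n‖ * ‖x‖ := fun n => by
    rw [norm_smul]
    calc _ ≤ ‖leadingFunctional (deflation T n) x‖ * 1 := by
          gcongr; exact norm_leadingDirection_le _
      _ ≤ _ := by
          rw [mul_one]
          exact (leadingFunctional _).le_of_opNorm_le (norm_leadingFunctional_le _) x
  refine (hasSum_iff_tendsto_nat_of_summable_norm
    (Summable.of_nonneg_of_le (fun _ => norm_nonneg _) hbound (hsum.mul_right ‖x‖))).mpr ?_
  have hres : Tendsto (fun n => deflation T n x) atTop (𝓝 0) := by
    refine squeeze_zero_norm (fun n => (deflation T n).le_opNorm x) ?_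
    simpa using hsum.tendsto_atTop_zero.mul_const ‖x‖
  have := (tendsto_const_nhds (x := T x)).sub hres
  rw [sub_zero] at this
  refine this.congr fun n => ?_
  rw [apply_eq_sum_add_deflation T n x]
  abel

end Deflation

section Volume

lemma norm_sum_smul_le_one {X : Type*} [NormedAddCommGroup X] [NormedSpace ℂ X] {m : ℕ}
    {x : Fin m → X} (hx : ∀ k, ‖x k‖ ≤ 1) {a : EuclideanSpace ℝ (Fin m)}
    (ha : √m * ‖a‖ ≤ 1) : ‖∑ k, (a k : ℂ) • x k‖ ≤ 1 := by
  calc ‖∑ k, (a k : ℂ) • x k‖ ≤ ∑ k, ‖a k‖ := by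
        refine norm_sum_le_of_le _ fun k _ => ?_
        rw [norm_smul, Complex.norm_real]
        exact mul_le_of_le_one_right (norm_nonneg _) (hx k)
    _ ≤ √m * ‖a‖ := by
        rw [EuclideanSpace.norm_eq, ← Real.sqrt_mul (by positivity)]
        refine Real.le_sqrt_of_sq_le ?_
        simpa using sq_sum_le_card_mul_sum_sq (s := Finset.univ) (f := fun k => ‖a k‖)
    _ ≤ 1 := ha

/-- Volume comparison: if a linear image of a ball of radius `r` is covered by `N` balls of
radius `ε`, then the determinant is at most `N * (ε / r) ^ m`. -/
lemma abs_det_mul_pow_le_of_cover {m N : ℕ}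
    (L : EuclideanSpace ℝ (Fin m) →ₗ[ℝ] EuclideanSpace ℝ (Fin m)) {r ε : ℝ} (hr : 0 ≤ r)
    (hε : 0 ≤ ε) (c : Fin N → EuclideanSpace ℝ (Fin m))
    (hc : ∀ a, ‖a‖ ≤ r → ∃ i, ‖L a - c i‖ ≤ ε) :
    |LinearMap.det L| * r ^ m ≤ N * ε ^ m := by
  set μ : Measure (EuclideanSpace ℝ (Fin m)) := volume
  have hsub : L '' Metric.closedBall 0 r ⊆ ⋃ i, Metric.closedBall (c i) ε := by
    rintro _ ⟨a, ha, rfl⟩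
    obtain ⟨i, hi⟩ := hc a (by simpa using ha)
    exact Set.mem_iUnion.mpr ⟨i, by simpa [dist_eq_norm] using hi⟩
  have hvol := (measure_mono hsub).trans (measure_iUnion_fintype_le μ _)
  simp only [μ, Measure.addHaar_image_linearMap, Measure.addHaar_closedBall _ _ hr,
    Measure.addHaar_closedBall _ _ hε, finrank_euclideanSpace, Fintype.card_fin, Finset.sum_const,
    Finset.card_univ, nsmul_eq_mul] at hvol
  rw [← mul_assoc, ← mul_assoc, ENNReal.mul_le_mul_iff_left
    (Metric.measure_ball_pos _ _ one_pos).ne' measure_ball_lt_top.ne,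
    ← ENNReal.ofReal_mul (abs_nonneg _), ← ENNReal.ofReal_natCast,
    ← ENNReal.ofReal_mul (by positivity), ENNReal.ofReal_le_ofReal_iff (by positivity)] at hvol
  exact hvol

end Volume

section Estimate

variable {X H : Type*} [NormedAddCommGroup X] [NormedSpace ℂ X]
  [NormedAddCommGroup H] [InnerProductSpace ℂ H]

/-- The real parts of the coordinates of `v` with respect to the family `e`. -/
def reCoords {m : ℕ} (e : Fin m → H) (v : H) : EuclideanSpace ℝ (Fin m) :=
  WithLp.toLp 2 fun j => (inner ℂ (e j) v).re

lemma norm_reCoords_sub_le {m : ℕ} {e : Fin m → H} (he : Orthonormal ℂ e) (v w : H) :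
    ‖reCoords e v - reCoords e w‖ ≤ ‖v - w‖ := by
  rw [EuclideanSpace.norm_eq]
  refine Real.sqrt_le_iff.mpr ⟨norm_nonneg _, le_trans ?_ (he.sum_inner_products_le (v - w)
    (s := Finset.univ))⟩
  refine Finset.sum_le_sum fun j _ => ?_
  have hj : (reCoords e v - reCoords e w) j = (inner ℂ (e j) (v - w)).re := by
    simp [reCoords]
  rw [hj]
  gcongr
  exact Complex.abs_re_le_norm _

lemma prod_norm_deflation_le (T : X →L[ℂ] H) {m : ℕ} (h : ∀ k < m, deflation T k ≠ 0) {ε : ℝ}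
    (hε : 0 ≤ ε) (hN : epsContent T ε ≠ ⊤) :
    ∏ k : Fin m, ‖deflation T k (almostNorming (deflation T k))‖ ≤
      (epsContent T ε).toNat * (√m * ε) ^ m := by
  set x : Fin m → X := fun k => almostNorming (deflation T k)
  set e : Fin m → H := fun k => leadingDirection (deflation T k)
  have he : Orthonormal ℂ e := orthonormal_leadingDirection T h
  set M : Matrix (Fin m) (Fin m) ℝ := fun j k => (inner ℂ (e j) (T (x k))).re
  have hM : ∀ j k, M j k = (leadingFunctional (deflation T j) (x k)).re := fun j k => by
    rw [leadingFunctional_deflation_apply]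
  have hdet : M.det = ∏ k : Fin m, ‖deflation T k (x k)‖ := by
    rw [Matrix.det_of_isUpperTriangular]
    · refine Finset.prod_congr rfl fun k _ => ?_
      rw [hM, leadingFunctional_almostNorming, Complex.ofReal_re]
    · intro j k hkj
      rw [hM, leadingFunctional_apply, deflation_almostNorming T (by simpa using hkj)]
      simp
  have hL : ∀ a, Matrix.toLpLin 2 2 M a = reCoords e (T (∑ k, (a k : ℂ) • x k)) := by
    intro a
    ext j
    rw [Matrix.toLpLin_apply]
    simp [Matrix.mulVec, dotProduct, reCoords, M, mul_comm]
  obtain ⟨z, hz⟩ := exists_net_of_epsContent_ne_top T hN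
  have hr : √m * (√m)⁻¹ ≤ 1 := mul_inv_le_one
  have hcover := abs_det_mul_pow_le_of_cover (Matrix.toLpLin 2 2 M) (r := (√m)⁻¹)
    (by positivity) hε (fun i => reCoords e (T (z i))) fun a ha => by
      obtain ⟨i, hi⟩ := hz (∑ k, (a k : ℂ) • x k) (norm_sum_smul_le_one
        (fun k => norm_almostNorming_le _) ((mul_le_mul_of_nonneg_left ha (by positivity)).trans hr))
      exact ⟨i, by rw [hL]; exact (norm_reCoords_sub_le he _ _).trans hi⟩
  rw [Matrix.toLpLin_eq_toLin, LinearMap.det_toLin, hdet,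
    abs_of_nonneg (Finset.prod_nonneg fun _ _ => norm_nonneg _)] at hcover
  have hm : (√m)⁻¹ ^ m * √m ^ m = 1 := by
    rcases m.eq_zero_or_pos with rfl | hm
    · simp
    · rw [← mul_pow, inv_mul_cancel₀ (by positivity), one_pow]
  calc ∏ k : Fin m, ‖deflation T k (x k)‖
      = (∏ k : Fin m, ‖deflation T k (x k)‖) * (√m)⁻¹ ^ m * √m ^ m := by
        rw [mul_assoc, hm, mul_one]
    _ ≤ (epsContent T ε).toNat * ε ^ m * √m ^ m := by gcongr
    _ = _ := by ring

/-- The norms of the deflations are controlled by the `ε`-contents. -/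
lemma norm_deflation_le (T : X →L[ℂ] H) (m : ℕ) {ε : ℝ} (hε : 0 ≤ ε) (hN : epsContent T ε ≠ ⊤) :
    ‖deflation T m‖ ≤ 2 * (((m : ℝ) + 1) ^ ((1 : ℝ) / 2) * ε *
      ((epsContent T ε).toNat : ℝ) ^ ((1 : ℝ) / ((m : ℝ) + 1))) := by
  rcases eq_or_ne (deflation T m) 0 with h0 | h0
  · rw [h0, norm_zero]
    positivity
  have hne : ∀ k < m + 1, deflation T k ≠ 0 := fun k hk => norm_pos_iff.mp <|
    (norm_pos_iff.mpr h0).trans_le (norm_deflation_antitone T (Nat.le_of_lt_succ hk))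
  have hprod := prod_norm_deflation_le T hne hε hN
  refine le_of_pow_le_pow_left₀ (n := m + 1) m.succ_ne_zero (by positivity) ?_
  have hpow : (((epsContent T ε).toNat : ℝ) ^ ((1 : ℝ) / ((m : ℝ) + 1))) ^ (m + 1) =
      (epsContent T ε).toNat := by
    rw [one_div, ← Nat.cast_succ]
    exact Real.rpow_inv_natCast_pow (by positivity) m.succ_ne_zero
  calc ‖deflation T m‖ ^ (m + 1) = ∏ _k : Fin (m + 1), ‖deflation T m‖ := by simp
    _ ≤ ∏ k : Fin (m + 1), 2 * ‖deflation T k (almostNorming (deflation T k))‖ := by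
        refine Finset.prod_le_prod (fun _ _ => norm_nonneg _) fun k _ => ?_
        exact (norm_deflation_antitone T (Nat.le_of_lt_succ k.2)).trans
          (opNorm_le_two_mul_almostNorming _)
    _ = 2 ^ (m + 1) * ∏ k : Fin (m + 1), ‖deflation T k (almostNorming (deflation T k))‖ := by
        simp [Finset.prod_mul_distrib]
    _ ≤ 2 ^ (m + 1) * ((epsContent T ε).toNat * (√(m + 1 : ℕ) * ε) ^ (m + 1)) := by gcongr
    _ = _ := by
        rw [mul_pow 2, mul_pow _ (_ ^ _), hpow, ← Real.sqrt_eq_rpow]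
        push_cast
        ring

end Estimate

/-- Lemma A.2 (ii): for `0 < p ≤ 1` there is a constant `d = d_p > 0` such
that if `T` is a bounded map from a Banach space to a complex Hilbert space and `(ε_m)_{m ≥ 1}`
is a sequence of positive numbers with all `ε_m`-contents finite and
`∑_{m ≥ 1} (m^{1/2} ε_m N_T(ε_m)^{1/m})^p < ∞`, then `T` is `p`-nuclear with
`‖T‖_p ≤ d (∑_{m ≥ 1} (m^{1/2} ε_m N_T(ε_m)^{1/m})^p)^{1/p}`.
(The sequence is indexed by `m : ℕ` starting from `0`, representing the term of index `m + 1`.) -/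
theorem isPNuclear_of_epsContent (p : ℝ) (hp0 : 0 < p) (hp1 : p ≤ 1) :
    ∃ d : ℝ, 0 < d ∧
      ∀ (X H : Type) (_ : NormedAddCommGroup X) (_ : NormedSpace ℂ X) (_ : CompleteSpace X)
        (_ : NormedAddCommGroup H) (_ : InnerProductSpace ℂ H) (_ : CompleteSpace H)
        (T : X →L[ℂ] H) (ε : ℕ → ℝ),
        (∀ m, 0 < ε m) →
        (∀ m, epsContent T (ε m) ≠ ⊤) →
        Summable (fun m : ℕ =>
          (((m : ℝ) + 1) ^ ((1 : ℝ) / 2) * ε m *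
            (((epsContent T (ε m)).toNat : ℝ)) ^ ((1 : ℝ) / ((m : ℝ) + 1))) ^ p) →
        IsPNuclear p T ∧
          pNuclearNorm p T ≤ d *
            (∑' m : ℕ, (((m : ℝ) + 1) ^ ((1 : ℝ) / 2) * ε m *
              (((epsContent T (ε m)).toNat : ℝ)) ^ ((1 : ℝ) / ((m : ℝ) + 1))) ^ p) ^ (1 / p) := by
  refine ⟨2, two_pos, fun X H _ _ _ _ _ _ T ε hε hN hsum => ?_⟩
  set s : ℕ → ℝ := fun m => ((m : ℝ) + 1) ^ ((1 : ℝ) / 2) * ε m *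
    (((epsContent T (ε m)).toNat : ℝ)) ^ ((1 : ℝ) / ((m : ℝ) + 1))
  have hs : ∀ m, 0 ≤ s m := fun m => by have := (hε m).le; positivity
  have hres : ∀ m, ‖deflation T m‖ ^ p ≤ 2 ^ p * s m ^ p := fun m => by
    rw [← Real.mul_rpow zero_le_two (hs m)]
    exact Real.rpow_le_rpow (norm_nonneg _) (norm_deflation_le T m (hε m).le (hN m)) hp0.le
  have hrep := nuclearRep_of_summable_norm_deflation T hp0 hp1
    (Summable.of_nonneg_of_le (fun _ => by positivity) hres (hsum.mul_left _))
  have hterm : ∀ m, ‖leadingFunctional (deflation T m)‖ ^ p *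
      ‖leadingDirection (deflation T m)‖ ^ p ≤ 2 ^ p * s m ^ p := fun m => by
    refine le_trans ?_ (hres m)
    calc _ ≤ ‖deflation T m‖ ^ p * 1 := by
          gcongr
          · exact norm_leadingFunctional_le _
          · exact Real.rpow_le_one (norm_nonneg _) (norm_leadingDirection_le _) hp0.le
      _ = _ := mul_one _
  have hsummable := Summable.of_nonneg_of_le (fun _ => by positivity) hterm (hsum.mul_left _)
  refine ⟨⟨_, _, hrep, hsummable⟩, ?_⟩
  calc pNuclearNorm p T
      ≤ (∑' m, ‖leadingFunctional (deflation T m)‖ ^ p *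
          ‖leadingDirection (deflation T m)‖ ^ p) ^ (1 / p) := by
        refine csInf_le ⟨0, ?_⟩ ⟨_, _, hrep, hsummable, rfl⟩
        rintro _ ⟨f, y, -, -, rfl⟩
        exact Real.rpow_nonneg (tsum_nonneg fun _ => by positivity) _
    _ ≤ (2 ^ p * ∑' m, s m ^ p) ^ (1 / p) := by
        refine Real.rpow_le_rpow (tsum_nonneg fun _ => by positivity) ?_ (by positivity)
        rw [← tsum_mul_left]
        exact hsummable.tsum_le_tsum hterm (hsum.mul_left _)
    _ = 2 * (∑' m, s m ^ p) ^ (1 / p) := by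
        rw [Real.mul_rpow (by positivity)
          (tsum_nonneg fun m => Real.rpow_nonneg (hs m) _), ← Real.rpow_mul zero_le_two,
          mul_one_div_cancel hp0.ne', Real.rpow_one]
end
end

section
/- Let X₁, X₂, Y₁, Y₂, Z, W be Banach spaces, let 0 < p ≤ 1, and let T_i : X_i → Y_i be p-nuclear bounded linear maps (i = 1,2). Suppose φ : X₁ × X₂ → Z is a bounded bilinear map whose range spans a dense subspace of Z, satisfying the dual cross-norm property: for every f ∈ X₁* and g ∈ X₂* there is a bounded linear functional h ∈ Z* with h(φ(x₁,x₂)) = f(x₁)g(x₂) for all x₁, x₂ and ‖h‖ ≤ ‖f‖·‖g‖ (this holds in particular when the norm of Z restricted to the image of φ majorizes the injective cross-norm); and suppose ψ : Y₁ × Y₂ → W is a bilinear map satisfying the cross-norm estimate ‖ψ(y₁,y₂)‖ ≤ ‖y₁‖·‖y₂‖. Then there exists a unique bounded linear map S : Z → W such that S(φ(x₁,x₂)) = ψ(T₁x₁, T₂x₂) for all x₁ ∈ X₁, x₂ ∈ X₂; moreover S is p-nuclear and ‖S‖_p ≤ ‖T₁‖_p · ‖T₂‖_p. -/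
open scoped ENNReal NNReal

noncomputable section

open Filter

/-- For `p ≤ 1`, a `p`-summable nonnegative sequence is summable. -/
theorem summable_of_summable_rpow_of_le_one {ι : Type*} {p : ℝ} (hp0 : 0 < p) (hp1 : p ≤ 1)
    {u : ι → ℝ} (hu : ∀ i, 0 ≤ u i) (h : Summable fun i => u i ^ p) : Summable u := by
  refine Summable.of_norm_bounded_eventually h ?_
  have hlt : ∀ᶠ i in cofinite, u i ^ p < 1 :=
    h.tendsto_cofinite_zero.eventually (gt_mem_nhds zero_lt_one)
  filter_upwards [hlt] with i hi
  have hi1 : u i ≤ 1 := by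
    by_contra! hc
    exact absurd hi (Real.one_lt_rpow hc hp0).le.not_gt
  rw [Real.norm_of_nonneg (hu i)]
  simpa using Real.rpow_le_rpow_of_exponent_ge' (hu i) hi1 hp0.le hp1

/-- A `p`-summable pair of sequences is a nuclear representation of some bounded operator. -/
theorem exists_nuclearRep {X Y : Type*} [NormedAddCommGroup X] [NormedSpace ℂ X]
    [NormedAddCommGroup Y] [NormedSpace ℂ Y] [CompleteSpace Y] {p : ℝ} (hp0 : 0 < p)
    (hp1 : p ≤ 1) (f : ℕ → X →L[ℂ] ℂ) (y : ℕ → Y)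
    (h : Summable fun n => ‖f n‖ ^ p * ‖y n‖ ^ p) : ∃ T : X →L[ℂ] Y, NuclearRep T f y := by
  have hs : Summable fun n => ‖f n‖ * ‖y n‖ := by
    refine summable_of_summable_rpow_of_le_one hp0 hp1 (fun n => by positivity) ?_
    simpa only [Real.mul_rpow (norm_nonneg _) (norm_nonneg _)] using h
  have hop : Summable fun n => (f n).smulRight (y n) :=
    Summable.of_norm (by simpa only [ContinuousLinearMap.norm_smulRight_apply] using hs)
  exact ⟨∑' n, (f n).smulRight (y n), fun x => by
    simpa using (ContinuousLinearMap.apply ℂ Y x).hasSum hop.hasSum⟩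

/-- Bounded operators agreeing on the range of a bilinear map with dense span are equal. -/
theorem ContinuousLinearMap.ext_of_dense_span_bilinear {X₁ X₂ Z W : Type*}
    [NormedAddCommGroup X₁] [NormedSpace ℂ X₁] [NormedAddCommGroup X₂] [NormedSpace ℂ X₂]
    [NormedAddCommGroup Z] [NormedSpace ℂ Z] [NormedAddCommGroup W] [NormedSpace ℂ W]
    {φ : X₁ →L[ℂ] X₂ →L[ℂ] Z}
    (hdense : (Submodule.span ℂ {z : Z | ∃ x₁ x₂, z = φ x₁ x₂}).topologicalClosure = ⊤)
    {S S' : Z →L[ℂ] W} (h : ∀ x₁ x₂, S (φ x₁ x₂) = S' (φ x₁ x₂)) : S = S' := by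
  refine ContinuousLinearMap.ext_on
    ((Submodule.dense_iff_topologicalClosure_eq_top).2 hdense) ?_
  rintro _ ⟨x₁, x₂, rfl⟩
  exact h x₁ x₂

/-- Nuclear representations of `T₁` and `T₂` induce one of their tensor product. -/
theorem exists_nuclearRep_tensor {X₁ X₂ Y₁ Y₂ Z W : Type*}
    [NormedAddCommGroup X₁] [NormedSpace ℂ X₁] [NormedAddCommGroup X₂] [NormedSpace ℂ X₂]
    [NormedAddCommGroup Y₁] [NormedSpace ℂ Y₁] [NormedAddCommGroup Y₂] [NormedSpace ℂ Y₂]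
    [NormedAddCommGroup Z] [NormedSpace ℂ Z]
    [NormedAddCommGroup W] [NormedSpace ℂ W] [CompleteSpace W]
    {p : ℝ} (hp0 : 0 < p) (hp1 : p ≤ 1) {T₁ : X₁ →L[ℂ] Y₁} {T₂ : X₂ →L[ℂ] Y₂}
    (φ : X₁ →L[ℂ] X₂ →L[ℂ] Z)
    (hdual : ∀ (f : X₁ →L[ℂ] ℂ) (g : X₂ →L[ℂ] ℂ), ∃ h : Z →L[ℂ] ℂ,
      (∀ x₁ x₂, h (φ x₁ x₂) = f x₁ * g x₂) ∧ ‖h‖ ≤ ‖f‖ * ‖g‖)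
    (ψ : Y₁ →ₗ[ℂ] Y₂ →ₗ[ℂ] W) (hψ : ∀ y₁ y₂, ‖ψ y₁ y₂‖ ≤ ‖y₁‖ * ‖y₂‖)
    {f : ℕ → X₁ →L[ℂ] ℂ} {y : ℕ → Y₁} {g : ℕ → X₂ →L[ℂ] ℂ} {z : ℕ → Y₂}
    (h₁ : NuclearRep T₁ f y) (h₂ : NuclearRep T₂ g z)
    (hs₁ : Summable fun n => ‖f n‖ ^ p * ‖y n‖ ^ p)
    (hs₂ : Summable fun n => ‖g n‖ ^ p * ‖z n‖ ^ p) :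
    ∃ (S : Z →L[ℂ] W) (h : ℕ → Z →L[ℂ] ℂ) (w : ℕ → W),
      (∀ x₁ x₂, S (φ x₁ x₂) = ψ (T₁ x₁) (T₂ x₂)) ∧ NuclearRep S h w ∧
      Summable (fun n => ‖h n‖ ^ p * ‖w n‖ ^ p) ∧
      ∑' n, ‖h n‖ ^ p * ‖w n‖ ^ p ≤
        (∑' n, ‖f n‖ ^ p * ‖y n‖ ^ p) * ∑' n, ‖g n‖ ^ p * ‖z n‖ ^ p := by
  choose H hH hHn using hdual
  let e : ℕ ≃ ℕ × ℕ := Nat.pairEquiv.symm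
  let K : ℕ × ℕ → Z →L[ℂ] ℂ := fun q => H (f q.1) (g q.2)
  let V : ℕ × ℕ → W := fun q => ψ (y q.1) (z q.2)
  have hprod : Summable fun q : ℕ × ℕ =>
      (‖f q.1‖ ^ p * ‖y q.1‖ ^ p) * (‖g q.2‖ ^ p * ‖z q.2‖ ^ p) :=
    hs₁.mul_of_nonneg hs₂ (fun n => by positivity) (fun n => by positivity)
  have hle : ∀ q : ℕ × ℕ, ‖K q‖ ^ p * ‖V q‖ ^ p ≤
      (‖f q.1‖ ^ p * ‖y q.1‖ ^ p) * (‖g q.2‖ ^ p * ‖z q.2‖ ^ p) := fun q => by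
    calc ‖K q‖ ^ p * ‖V q‖ ^ p
        ≤ (‖f q.1‖ * ‖g q.2‖) ^ p * (‖y q.1‖ * ‖z q.2‖) ^ p := by
          gcongr
          exacts [hHn _ _, hψ _ _]
      _ = _ := by
          rw [Real.mul_rpow (norm_nonneg _) (norm_nonneg _),
            Real.mul_rpow (norm_nonneg _) (norm_nonneg _)]
          ring
  have hKV : Summable fun q : ℕ × ℕ => ‖K q‖ ^ p * ‖V q‖ ^ p :=
    Summable.of_nonneg_of_le (fun q => by positivity) hle hprod
  have hKVe : Summable fun n => ‖K (e n)‖ ^ p * ‖V (e n)‖ ^ p :=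
    (e.summable_iff (f := fun q => ‖K q‖ ^ p * ‖V q‖ ^ p)).2 hKV
  obtain ⟨S, hS⟩ := exists_nuclearRep hp0 hp1 (K ∘ e) (V ∘ e) hKVe
  refine ⟨S, K ∘ e, V ∘ e, fun x₁ x₂ => ?_, hS, hKVe, ?_⟩
  · let Ψ : Y₁ →L[ℂ] Y₂ →L[ℂ] W := ψ.mkContinuous₂ 1 (by simpa using hψ)
    have hsum : HasSum (fun q : ℕ × ℕ => K q (φ x₁ x₂) • V q) (S (φ x₁ x₂)) :=
      (e.hasSum_iff (f := fun q => K q (φ x₁ x₂) • V q)).1 (hS (φ x₁ x₂))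
    have hinner : ∀ m, HasSum (fun n => K (m, n) (φ x₁ x₂) • V (m, n))
        (Ψ (f m x₁ • y m) (T₂ x₂)) := fun m => by
      convert (Ψ (f m x₁ • y m)).hasSum (h₂ x₂) using 2 with n
      simp [Ψ, K, V, hH, mul_smul, smul_comm (f m x₁) (g n x₂)]
    exact (hsum.prod_fiberwise hinner).unique ((Ψ.flip (T₂ x₂)).hasSum (h₁ x₁))
  · calc ∑' n, ‖K (e n)‖ ^ p * ‖V (e n)‖ ^ p = ∑' q, ‖K q‖ ^ p * ‖V q‖ ^ p :=
          e.tsum_eq fun q => ‖K q‖ ^ p * ‖V q‖ ^ p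
      _ ≤ _ := hKV.tsum_le_tsum hle hprod
      _ = _ := (hs₁.tsum_mul_tsum hs₂ hprod).symm

/-- A lower bound for all products `a * b` bounds the product of the infima. -/
theorem le_csInf_mul_csInf {A B : Set ℝ} (hA : A.Nonempty) (hA' : BddBelow A)
    (hB : B.Nonempty) (hB' : BddBelow B) {c : ℝ} (h : ∀ a ∈ A, ∀ b ∈ B, c ≤ a * b) :
    c ≤ sInf A * sInf B :=
  (isClosed_Ici (a := c)).closure_subset <|
    map_mem_closure₂ continuous_mul (csInf_mem_closure hA hA') (csInf_mem_closure hB hB') h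

/-- The set whose infimum is the nuclear `p`-norm is bounded below. -/
theorem bddBelow_pNuclearNorm_set {X Y : Type*} [NormedAddCommGroup X] [NormedSpace ℂ X]
    [NormedAddCommGroup Y] [NormedSpace ℂ Y] (p : ℝ) (T : X →L[ℂ] Y) :
    BddBelow {c : ℝ | ∃ (f : ℕ → X →L[ℂ] ℂ) (y : ℕ → Y), NuclearRep T f y ∧
      Summable (fun n => ‖f n‖ ^ p * ‖y n‖ ^ p) ∧
      c = (∑' n, ‖f n‖ ^ p * ‖y n‖ ^ p) ^ (1 / p)} := by
  refine ⟨0, ?_⟩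
  rintro _ ⟨f, y, -, -, rfl⟩
  exact Real.rpow_nonneg (tsum_nonneg fun n => by positivity) _

/-- Lemma A.3: existence, uniqueness and `p`-nuclearity of the tensor
product of two `p`-nuclear maps. Here `Z` plays the role of the tensor product
`X₁ ⊗_α X₂` with respect to a cross-norm `α` majorizing the injective cross-norm (this is
encoded by the bounded bilinear map `φ` with dense span and the dual cross-norm property),
and `W` plays the role of the tensor product `Y₁ ⊗_β Y₂` with respect to a cross-norm `β`
(encoded by the bilinear map `ψ` satisfying the cross-norm estimate). -/
theorem tensor_pNuclear {X₁ X₂ Y₁ Y₂ Z W : Type*}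
    [NormedAddCommGroup X₁] [NormedSpace ℂ X₁] [CompleteSpace X₁]
    [NormedAddCommGroup X₂] [NormedSpace ℂ X₂] [CompleteSpace X₂]
    [NormedAddCommGroup Y₁] [NormedSpace ℂ Y₁] [CompleteSpace Y₁]
    [NormedAddCommGroup Y₂] [NormedSpace ℂ Y₂] [CompleteSpace Y₂]
    [NormedAddCommGroup Z] [NormedSpace ℂ Z] [CompleteSpace Z]
    [NormedAddCommGroup W] [NormedSpace ℂ W] [CompleteSpace W]
    (p : ℝ) (hp0 : 0 < p) (hp1 : p ≤ 1)
    (T₁ : X₁ →L[ℂ] Y₁) (T₂ : X₂ →L[ℂ] Y₂)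
    (hT₁ : IsPNuclear p T₁) (hT₂ : IsPNuclear p T₂)
    -- φ is a bounded bilinear map whose range spans a dense subspace of Z
    (φ : X₁ →L[ℂ] X₂ →L[ℂ] Z)
    (hdense : (Submodule.span ℂ {z : Z | ∃ x₁ x₂, z = φ x₁ x₂}).topologicalClosure = ⊤)
    -- dual cross-norm property (the norm of Z majorizes the injective cross-norm)
    (hdual : ∀ (f : X₁ →L[ℂ] ℂ) (g : X₂ →L[ℂ] ℂ), ∃ h : Z →L[ℂ] ℂ,
      (∀ x₁ x₂, h (φ x₁ x₂) = f x₁ * g x₂) ∧ ‖h‖ ≤ ‖f‖ * ‖g‖)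
    -- ψ is a bilinear map satisfying the cross-norm estimate
    (ψ : Y₁ →ₗ[ℂ] Y₂ →ₗ[ℂ] W)
    (hψ : ∀ y₁ y₂, ‖ψ y₁ y₂‖ ≤ ‖y₁‖ * ‖y₂‖) :
    (∃! S : Z →L[ℂ] W, ∀ x₁ x₂, S (φ x₁ x₂) = ψ (T₁ x₁) (T₂ x₂)) ∧
    ∀ S : Z →L[ℂ] W, (∀ x₁ x₂, S (φ x₁ x₂) = ψ (T₁ x₁) (T₂ x₂)) →
      IsPNuclear p S ∧ pNuclearNorm p S ≤ pNuclearNorm p T₁ * pNuclearNorm p T₂ := by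
  have key := fun f y g z h₁ h₂ hs₁ hs₂ => exists_nuclearRep_tensor (T₁ := T₁) (T₂ := T₂)
    (f := f) (y := y) (g := g) (z := z) hp0 hp1 φ hdual ψ hψ h₁ h₂ hs₁ hs₂
  have huniq : ∀ S S' : Z →L[ℂ] W, (∀ x₁ x₂, S (φ x₁ x₂) = ψ (T₁ x₁) (T₂ x₂)) →
      (∀ x₁ x₂, S' (φ x₁ x₂) = ψ (T₁ x₁) (T₂ x₂)) → S = S' := fun S S' hS hS' =>
    ContinuousLinearMap.ext_of_dense_span_bilinear hdense fun x₁ x₂ => by rw [hS, hS']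
  obtain ⟨f, y, h₁, hs₁⟩ := hT₁
  obtain ⟨g, z, h₂, hs₂⟩ := hT₂
  obtain ⟨S₀, h, w, hS₀, hrep, hsum, -⟩ := key f y g z h₁ h₂ hs₁ hs₂
  refine ⟨⟨S₀, hS₀, fun S hS => huniq S S₀ hS hS₀⟩, fun S hS => ?_⟩
  obtain rfl := huniq S S₀ hS hS₀
  refine ⟨⟨h, w, hrep, hsum⟩, ?_⟩
  refine le_csInf_mul_csInf ?_ (bddBelow_pNuclearNorm_set p T₁) ?_
    (bddBelow_pNuclearNorm_set p T₂) ?_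
  · exact ⟨_, f, y, h₁, hs₁, rfl⟩
  · exact ⟨_, g, z, h₂, hs₂, rfl⟩
  rintro _ ⟨f', y', h₁', hs₁', rfl⟩ _ ⟨g', z', h₂', hs₂', rfl⟩
  obtain ⟨S', h', w', hS', hrep', hsum', hle⟩ := key f' y' g' z' h₁' h₂' hs₁' hs₂'
  obtain rfl := huniq S S' hS hS'
  rw [← Real.mul_rpow (tsum_nonneg fun n => by positivity) (tsum_nonneg fun n => by positivity)]
  refine (csInf_le (bddBelow_pNuclearNorm_set p S) ⟨h', w', hrep', hsum', rfl⟩).trans ?_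
  exact Real.rpow_le_rpow (tsum_nonneg fun n => by positivity) hle (by positivity)
end
end
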